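/- Let r ≥ 1 and let m_1, m_2, m_3 be non-negative integers with m_1 ≥ 1, m_3 ≥ 1 and m_1 + m_2 + m_3 = r+1. The ideal I of ℂ[Z_1,Z_2,Z_3] generated by Z_1^{r+2-m_1}, Z_2^{r+1-m_2}, Z_3^{r+2-m_3}, (Z_1Z_2)^{m_3}, (Z_2Z_3)^{m_1}, (Z_3Z_1)^{m_2+1}, Z_1Z_2Z_3 is A_r(3)-invariant, the quotient ℂ[Z_1,Z_2,Z_3]/I has dimension (r+1)^2, and it is isomorphic to the regular representation of A_r(3), i.e. every character of A_r(3) occurs in it with multiplicity exactly one. -/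

import Mathlib

open MvPolynomial

noncomputable section

/-- The abelian group `A_r(n)`: diagonal matrices (encoded as tuples of units)
`d` with `d i ^ (r+1) = 1` for all `i` and `∏ i, d i = 1` (determinant one). -/
def ArGroup (r n : ℕ) : Subgroup (Fin n → ℂˣ) where
  carrier := {d | (∀ i, d i ^ (r + 1) = 1) ∧ ∏ i, d i = 1}
  one_mem' := ⟨fun _ => one_pow _, Finset.prod_const_one⟩
  mul_mem' := by
    rintro a b ⟨ha1, ha2⟩ ⟨hb1, hb2⟩
    refine ⟨fun i => ?_, ?_⟩
    · simp [Pi.mul_apply, mul_pow, ha1 i, hb1 i]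
    · simp [Finset.prod_mul_distrib, ha2, hb2]
  inv_mem' := by
    rintro a ⟨ha1, ha2⟩
    refine ⟨fun i => ?_, ?_⟩
    · rw [Pi.inv_apply, inv_pow, ha1 i, inv_one]
    · simp [Finset.prod_inv_distrib, ha2]

/-- The action of a diagonal element `d` on polynomials, `Z i ↦ d i • Z i`. -/
def actA {n : ℕ} (d : Fin n → ℂˣ) :
    MvPolynomial (Fin n) ℂ →ₐ[ℂ] MvPolynomial (Fin n) ℂ :=
  aeval fun i => C (d i : ℂ) * X i

/-- The `ρ`-isotypic component (as a set) of the `A_r(n)`-module `ℂ[Z]/I`: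
those classes `w` such that for every `g` in the group and every representative `p`
of `w`, the class of `g · p` equals `ρ(g) • w`. -/
def iso (r n : ℕ) (I : Ideal (MvPolynomial (Fin n) ℂ)) (ρ : ArGroup r n →* ℂˣ) :
    Set (MvPolynomial (Fin n) ℂ ⧸ I) :=
  {w | ∀ g : ArGroup r n, ∀ p, Ideal.Quotient.mk I p = w →
    Ideal.Quotient.mk I (actA (g : Fin n → ℂˣ) p) = (ρ g : ℂ) • w}

end

section MonomialIdeal

variable {n : ℕ}

theorem coeff_actA (d : Fin n → ℂˣ) (p : MvPolynomial (Fin n) ℂ) (e : Fin n →₀ ℕ) :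
    coeff e (actA d p) = ((∏ i, d i ^ e i : ℂˣ) : ℂ) * coeff e p := by
  classical
  induction p using MvPolynomial.induction_on' with
  | add p q hp hq => simp only [map_add, coeff_add, hp, hq, mul_add]
  | monomial s a =>
    have h : actA d (monomial s a) = monomial s (((∏ i, d i ^ s i : ℂˣ) : ℂ) * a) := by
      rw [actA, aeval_monomial, monomial_eq, Finsupp.prod_fintype _ _ (by simp),
        Finsupp.prod_fintype _ _ (by simp), algebraMap_eq]
      simp only [mul_pow, Finset.prod_mul_distrib, Units.coe_prod, Units.val_pow_eq_pow_val,
        map_mul, map_prod, map_pow]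
      ring
    rw [h, coeff_monomial, coeff_monomial]
    split_ifs with hs
    · rw [hs]
    · simp

/-- The ideal generated by the monomials with exponents in `G`. -/
noncomputable def monomialIdeal (G : Set (Fin n →₀ ℕ)) : Ideal (MvPolynomial (Fin n) ℂ) :=
  Ideal.span ((fun s => monomial s (1 : ℂ)) '' G)

/-- The exponents of the monomials outside `monomialIdeal G`. -/
def standardExponents (G : Set (Fin n →₀ ℕ)) : Set (Fin n →₀ ℕ) :=
  {e | ∀ s ∈ G, ¬ s ≤ e}

variable {G : Set (Fin n →₀ ℕ)}

theorem mem_monomialIdeal_iff {p : MvPolynomial (Fin n) ℂ} :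
    p ∈ monomialIdeal G ↔ ∀ e ∈ standardExponents G, coeff e p = 0 := by
  rw [monomialIdeal, mem_ideal_span_monomial_image]
  refine forall_congr' fun e => ?_
  rw [mem_support_iff, ← not_imp_not]
  simp [standardExponents]

theorem actA_mem_monomialIdeal (d : Fin n → ℂˣ) {p : MvPolynomial (Fin n) ℂ}
    (hp : p ∈ monomialIdeal G) : actA d p ∈ monomialIdeal G := by
  rw [mem_monomialIdeal_iff] at hp ⊢
  intro e he
  rw [coeff_actA, hp e he, mul_zero]

theorem finrank_quotient_monomialIdeal [Finite (standardExponents G)] :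
    Module.finrank ℂ (MvPolynomial (Fin n) ℂ ⧸ monomialIdeal G) =
      Nat.card (standardExponents G) := by
  classical
  have := Fintype.ofFinite (standardExponents G)
  let f : MvPolynomial (Fin n) ℂ →ₗ[ℂ] (standardExponents G → ℂ) :=
    LinearMap.pi fun e => lcoeff ℂ e.1
  have hker : (monomialIdeal G).restrictScalars ℂ = LinearMap.ker f := by
    ext p
    simp [f, mem_monomialIdeal_iff, funext_iff]
  have hsurj : Function.Surjective f := by
    intro x
    refine ⟨∑ e, monomial e.1 (x e), ?_⟩
    ext e
    simp [f, coeff_monomial, Subtype.coe_inj]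
  rw [← ((Submodule.Quotient.restrictScalarsEquiv ℂ (monomialIdeal G)).symm.trans
    ((Submodule.quotEquivOfEq _ _ hker).trans
      (f.quotKerEquivOfSurjective hsurj))).symm.finrank_eq]
  simp

theorem mk_mem_iso_monomialIdeal_iff {r : ℕ} {ρ : ArGroup r n →* ℂˣ}
    {p : MvPolynomial (Fin n) ℂ} :
    Ideal.Quotient.mk (monomialIdeal G) p ∈ iso r n (monomialIdeal G) ρ ↔
      ∀ e ∈ standardExponents G, coeff e p ≠ 0 →
        ∀ g : ArGroup r n, ∏ i, (g : Fin n → ℂˣ) i ^ e i = ρ g := by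
  have key (g : ArGroup r n) (q : MvPolynomial (Fin n) ℂ) :
      Ideal.Quotient.mk (monomialIdeal G) (actA (g : Fin n → ℂˣ) q) =
        (ρ g : ℂ) • Ideal.Quotient.mk (monomialIdeal G) q ↔
      ∀ e ∈ standardExponents G, coeff e q ≠ 0 →
        ∏ i, (g : Fin n → ℂˣ) i ^ e i = ρ g := by
    have hsmul : (ρ g : ℂ) • Ideal.Quotient.mk (monomialIdeal G) q =
      Ideal.Quotient.mk (monomialIdeal G) ((ρ g : ℂ) • q) := rfl
    rw [hsmul, Ideal.Quotient.mk_eq_mk_iff_sub_mem, mem_monomialIdeal_iff]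
    refine forall₂_congr fun e _ => ?_
    rw [coeff_sub, coeff_actA, coeff_smul, smul_eq_mul, ← sub_mul, mul_eq_zero, sub_eq_zero,
      Units.val_inj]
    tauto
  constructor
  · intro h e he hc g
    exact (key g p).1 (h g p rfl) e he hc
  · intro h g q hq
    have hcoeff : ∀ e ∈ standardExponents G, coeff e q = coeff e p := by
      rw [Ideal.Quotient.mk_eq_mk_iff_sub_mem, mem_monomialIdeal_iff] at hq
      simpa [sub_eq_zero] using hq
    rw [← hq, key]
    intro e he hc
    exact h e he (hcoeff e he ▸ hc) g

theorem exists_iso_monomialIdeal_eq_span {r : ℕ} {ρ : ArGroup r n →* ℂˣ}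
    (h : ∃! e, e ∈ standardExponents G ∧
      ∀ g : ArGroup r n, ∏ i, (g : Fin n → ℂˣ) i ^ e i = ρ g) :
    ∃ w ∈ iso r n (monomialIdeal G) ρ, w ≠ 0 ∧
      ∀ w' ∈ iso r n (monomialIdeal G) ρ, ∃ a : ℂ, w' = a • w := by
  classical
  obtain ⟨e, ⟨he, hρ⟩, huniq⟩ := h
  refine ⟨Ideal.Quotient.mk _ (monomial e 1), ?_, ?_, ?_⟩
  · rw [mk_mem_iso_monomialIdeal_iff]
    intro s _ hs
    obtain rfl : e = s := by
      by_contra hne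
      exact hs (by rw [coeff_monomial, if_neg hne])
    exact hρ
  · rw [Ne, Ideal.Quotient.eq_zero_iff_mem, mem_monomialIdeal_iff]
    intro h
    simpa using h e he
  · intro w' hw'
    obtain ⟨p, rfl⟩ := Ideal.Quotient.mk_surjective w'
    rw [mk_mem_iso_monomialIdeal_iff] at hw'
    refine ⟨coeff e p, ?_⟩
    change _ = Ideal.Quotient.mk (monomialIdeal G) (coeff e p • monomial e 1)
    rw [Ideal.Quotient.mk_eq_mk_iff_sub_mem, mem_monomialIdeal_iff]
    intro s hs
    by_cases hse : e = s
    · subst hse; simp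
    · have : coeff s p = 0 := by
        by_contra hc
        exact hse (huniq s ⟨hs, hw' s hs hc⟩).symm
      simp [coeff_monomial, hse, this]

end MonomialIdeal

section Characters

variable {r : ℕ}

/-- The element `(x, y, (x * y)⁻¹)` of `ArGroup r 3`. -/
def arElement (x y : ℂˣ) (hx : x ^ (r + 1) = 1) (hy : y ^ (r + 1) = 1) : ArGroup r 3 :=
  ⟨![x, y, (x * y)⁻¹], by
    refine ⟨fun i => ?_, ?_⟩
    · fin_cases i <;> simp [mul_pow, hx, hy]
    · simp [Fin.prod_univ_three]⟩

theorem eq_arElement (g : ArGroup r 3) :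
    g = arElement (g.1 0) (g.1 1) (g.2.1 0) (g.2.1 1) := by
  have h := g.2.2
  rw [Fin.prod_univ_three] at h
  ext i : 2
  fin_cases i
  · rfl
  · rfl
  · exact eq_inv_of_mul_eq_one_right h

theorem exists_zmod_forall_weight_eq_iff (ρ : ArGroup r 3 →* ℂˣ) :
    ∃ x y : ZMod (r + 1), ∀ e : Fin 3 →₀ ℕ,
      (∀ g : ArGroup r 3, ∏ i, (g : Fin 3 → ℂˣ) i ^ e i = ρ g) ↔
        (e 0 - e 2 : ZMod (r + 1)) = x ∧ (e 1 - e 2 : ZMod (r + 1)) = y := by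
  obtain ⟨ζ, hζ⟩ : ∃ ζ : ℂˣ, IsPrimitiveRoot ζ (r + 1) :=
    ⟨_, (Complex.isPrimitiveRoot_exp (r + 1) r.succ_ne_zero).isUnit_unit r.succ_ne_zero⟩
  have hpow (z : ℂˣ) (hz : z ^ (r + 1) = 1) : ∃ i : ℕ, z = ζ ^ i := by
    obtain ⟨i, -, hi⟩ := (IsPrimitiveRoot.coe_units_iff.2 hζ).eq_pow_of_pow_eq_one
      (ξ := (z : ℂ)) (by rw [← Units.val_pow_eq_pow_val, hz, Units.val_one])
    exact ⟨i, Units.ext (by simpa using hi.symm)⟩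
  have hcast (a c u : ℕ) : (a - c : ZMod (r + 1)) = u ↔ ζ ^ a * (ζ ^ c)⁻¹ = ζ ^ u := by
    rw [← mul_inv_eq_one (b := ζ ^ u), ← sub_eq_zero]
    have h1 : ((a - c - u : ℤ) : ZMod (r + 1)) = a - c - u := by push_cast; rfl
    have h2 : ζ ^ a * (ζ ^ c)⁻¹ * (ζ ^ u)⁻¹ = ζ ^ (a - c - u : ℤ) := by
      simp [zpow_sub]
    rw [← h1, h2, hζ.zpow_eq_one_iff_dvd, ZMod.intCast_zmod_eq_zero_iff_dvd]
  let g₁ : ArGroup r 3 := arElement ζ 1 hζ.pow_eq_one (one_pow _)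
  let g₂ : ArGroup r 3 := arElement 1 ζ (one_pow _) hζ.pow_eq_one
  have hgen (g : ArGroup r 3) : ∃ i j : ℕ, g = g₁ ^ i * g₂ ^ j := by
    obtain ⟨i, hi⟩ := hpow (g.1 0) (g.2.1 0)
    obtain ⟨j, hj⟩ := hpow (g.1 1) (g.2.1 1)
    refine ⟨i, j, ?_⟩
    rw [eq_arElement g]
    ext k : 2
    fin_cases k
    · simp [arElement, g₁, g₂, hi]
    · simp [arElement, g₁, g₂, hj]
    · simpa [arElement, g₁, g₂, hi, hj] using mul_comm _ _
  have hroot (g : ArGroup r 3) (hg : g ^ (r + 1) = 1) : ∃ u : ℕ, ρ g = ζ ^ u :=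
    hpow _ (by rw [← map_pow, hg, map_one])
  have hord (g : ArGroup r 3) : g ^ (r + 1) = 1 := by
    ext k : 2
    exact g.2.1 k
  obtain ⟨u, hu⟩ := hroot g₁ (hord g₁)
  obtain ⟨v, hv⟩ := hroot g₂ (hord g₂)
  refine ⟨u, v, fun e => ?_⟩
  rw [hcast, hcast]
  let χ : ArGroup r 3 →* ℂˣ :=
    { toFun := fun g => ∏ i, (g : Fin 3 → ℂˣ) i ^ e i
      map_one' := by simp
      map_mul' := fun g h => by simp [mul_pow, Finset.prod_mul_distrib] }
  have h₁ : χ g₁ = ζ ^ e 0 * (ζ ^ e 2)⁻¹ := by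
    simp [χ, g₁, arElement, Fin.prod_univ_three]
  have h₂ : χ g₂ = ζ ^ e 1 * (ζ ^ e 2)⁻¹ := by
    simp [χ, g₂, arElement, Fin.prod_univ_three]
  rw [← h₁, ← h₂, ← hu, ← hv]
  refine ⟨fun h => ⟨h g₁, h g₂⟩, fun h g => ?_⟩
  change χ g = ρ g
  obtain ⟨i, j, rfl⟩ := hgen g
  rw [map_mul, map_mul, map_pow, map_pow, map_pow, map_pow, h.1, h.2]

end Characters

section Exponents

variable {r m1 m2 m3 : ℕ}

/-- The exponents of the monomial generators of the ideal. -/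
def generatorExponents (r m1 m2 m3 : ℕ) : Set (Fin 3 →₀ ℕ) :=
  {Finsupp.single 0 (r + 2 - m1), Finsupp.single 1 (r + 1 - m2), Finsupp.single 2 (r + 2 - m3),
    Finsupp.single 0 m3 + Finsupp.single 1 m3, Finsupp.single 1 m1 + Finsupp.single 2 m1,
    Finsupp.single 2 (m2 + 1) + Finsupp.single 0 (m2 + 1),
    Finsupp.single 0 1 + Finsupp.single 1 1 + Finsupp.single 2 1}

theorem monomialIdeal_generatorExponents :
    monomialIdeal (generatorExponents r m1 m2 m3) =
      Ideal.span {(X 0 : MvPolynomial (Fin 3) ℂ) ^ (r + 2 - m1),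
        X 1 ^ (r + 1 - m2), X 2 ^ (r + 2 - m3),
        (X 0 * X 1) ^ m3, (X 1 * X 2) ^ m1, (X 2 * X 0) ^ (m2 + 1),
        X 0 * X 1 * X 2} := by
  have hadd (s t : Fin 3 →₀ ℕ) :
      monomial (s + t) (1 : ℂ) = monomial s 1 * monomial t 1 := by
    rw [monomial_mul, one_mul]
  simp only [monomialIdeal, generatorExponents, Set.image_insert_eq, Set.image_singleton, hadd,
    ← X_pow_eq_monomial, mul_pow, pow_one]

theorem mem_standardExponents_generatorExponents {e : Fin 3 →₀ ℕ} :
    e ∈ standardExponents (generatorExponents r m1 m2 m3) ↔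
      e 0 < r + 2 - m1 ∧ e 1 < r + 1 - m2 ∧ e 2 < r + 2 - m3 ∧
      (e 0 < m3 ∨ e 1 < m3) ∧ (e 1 < m1 ∨ e 2 < m1) ∧ (e 2 < m2 + 1 ∨ e 0 < m2 + 1) ∧
      (e 0 = 0 ∨ e 1 = 0 ∨ e 2 = 0) := by
  simp only [standardExponents, generatorExponents, Set.mem_ofPred_eq, Set.mem_insert_iff,
    Set.mem_singleton_iff, forall_eq_or_imp, forall_eq, Finsupp.le_def, Fin.forall_fin_succ]
  simp [Finsupp.single_apply]
  grind

/-- The weight of an exponent, as an element of the character group of `ArGroup r 3`. -/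
def exponentWeight (r : ℕ) (e : Fin 3 →₀ ℕ) : ZMod (r + 1) × ZMod (r + 1) :=
  (e 0 - e 2, e 1 - e 2)

theorem natCast_sub_eq_iff {a b c d : ℕ} (ha : a ≤ r) (hb : b ≤ r) (hc : c ≤ r) (hd : d ≤ r) :
    (a - b : ZMod (r + 1)) = c - d ↔
      a + d = c + b ∨ a + d = c + b + (r + 1) ∨ a + d + (r + 1) = c + b := by
  rw [sub_eq_sub_iff_add_eq_add]
  norm_cast
  rw [ZMod.natCast_eq_natCast_iff, Nat.modEq_iff_dvd]
  push_cast
  constructor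
  · rintro ⟨k, hk⟩
    have h1 : k < 2 := by by_contra!; nlinarith
    have h2 : -2 < k := by by_contra!; nlinarith
    interval_cases k <;> omega
  · rintro (h | h | h)
    · exact ⟨0, by omega⟩
    · exact ⟨-1, by omega⟩
    · exact ⟨1, by omega⟩

theorem injOn_exponentWeight (hm1 : 1 ≤ m1) (hm3 : 1 ≤ m3) (hsum : m1 + m2 + m3 = r + 1) :
    Set.InjOn (exponentWeight r) (standardExponents (generatorExponents r m1 m2 m3)) := by
  intro e he f hf h
  rw [mem_standardExponents_generatorExponents] at he hf
  rw [exponentWeight, exponentWeight, Prod.mk.injEq,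
    natCast_sub_eq_iff (by omega) (by omega) (by omega) (by omega),
    natCast_sub_eq_iff (by omega) (by omega) (by omega) (by omega)] at h
  have : e 0 = f 0 ∧ e 1 = f 1 ∧ e 2 = f 2 := by omega
  ext i
  fin_cases i
  exacts [this.1, this.2.1, this.2.2]

theorem surjOn_exponentWeight (hm1 : 1 ≤ m1) (hm3 : 1 ≤ m3) (hsum : m1 + m2 + m3 = r + 1) :
    Set.SurjOn (exponentWeight r) (standardExponents (generatorExponents r m1 m2 m3))
      Set.univ := by
  rintro ⟨x, y⟩ -
  have hx : x.val ≤ r := Nat.lt_succ_iff.1 x.val_lt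
  have hy : y.val ≤ r := Nat.lt_succ_iff.1 y.val_lt
  obtain ⟨a, b, c, ha, hb, hc, hmem, hax, hby⟩ : ∃ a b c : ℕ, a ≤ r ∧ b ≤ r ∧ c ≤ r ∧
      (a < r + 2 - m1 ∧ b < r + 1 - m2 ∧ c < r + 2 - m3 ∧
      (a < m3 ∨ b < m3) ∧ (b < m1 ∨ c < m1) ∧ (c < m2 + 1 ∨ a < m2 + 1) ∧
      (a = 0 ∨ b = 0 ∨ c = 0)) ∧
      (a + 0 = x.val + c ∨ a + 0 = x.val + c + (r + 1) ∨ a + 0 + (r + 1) = x.val + c) ∧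
      (b + 0 = y.val + c ∨ b + 0 = y.val + c + (r + 1) ∨ b + 0 + (r + 1) = y.val + c) := by
    generalize x.val = u at *
    generalize y.val = v at *
    by_cases h₀ : u < r + 2 - m1 ∧ v < r + 1 - m2 ∧ (u < m3 ∨ v < m3)
    · exact ⟨u, v, 0, by omega⟩
    rcases le_or_gt u v with huv | huv
    · by_cases h₁ : 0 < u ∧ v - u < r + 1 - m2 ∧ r + 1 - u < r + 2 - m3 ∧
          (v - u < m1 ∨ r + 1 - u < m1)
      · exact ⟨0, v - u, r + 1 - u, by omega⟩
      · exact ⟨r + 1 + u - v, 0, r + 1 - v, by omega⟩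
    · by_cases h₁ : 0 < v ∧ u - v < r + 2 - m1 ∧ r + 1 - v < r + 2 - m3 ∧
          (r + 1 - v < m2 + 1 ∨ u - v < m2 + 1)
      · exact ⟨u - v, 0, r + 1 - v, by omega⟩
      · exact ⟨0, r + 1 + v - u, r + 1 - u, by omega⟩
  refine ⟨Finsupp.equivFunOnFinite.symm ![a, b, c],
    mem_standardExponents_generatorExponents.2 (by simpa using hmem), ?_⟩
  have h₁ := (natCast_sub_eq_iff ha hc hx (Nat.zero_le r)).2 hax
  have h₂ := (natCast_sub_eq_iff hb hc hy (Nat.zero_le r)).2 hby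
  simpa [exponentWeight] using And.intro h₁ h₂

theorem bijective_exponentWeight (hm1 : 1 ≤ m1) (hm3 : 1 ≤ m3) (hsum : m1 + m2 + m3 = r + 1) :
    Function.Bijective fun e : standardExponents (generatorExponents r m1 m2 m3) =>
      exponentWeight r e :=
  ⟨(injOn_exponentWeight hm1 hm3 hsum).injective, fun x => by
    obtain ⟨e, he, h⟩ := surjOn_exponentWeight hm1 hm3 hsum (Set.mem_univ x)
    exact ⟨⟨e, he⟩, h⟩⟩

end Exponents

/-- For `m_1, m_3 ≥ 1`, `m_1 + m_2 + m_3 = r+1`, the monomial ideal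
`⟨Z_1^(r+2−m_1), Z_2^(r+1−m_2), Z_3^(r+2−m_3), (Z_1Z_2)^(m_3), (Z_2Z_3)^(m_1),
(Z_3Z_1)^(m_2+1), Z_1Z_2Z_3⟩` is `A_r(3)`-invariant, the quotient has dimension
`(r+1)^2`, and every character of `A_r(3)` occurs in it with multiplicity one. -/
theorem Ar3_monomial_ideal_d_regular (r m1 m2 m3 : ℕ) (hr : 1 ≤ r) (hm1 : 1 ≤ m1)
    (hm3 : 1 ≤ m3) (hsum : m1 + m2 + m3 = r + 1) :
    let I : Ideal (MvPolynomial (Fin 3) ℂ) :=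
      Ideal.span {(X 0 : MvPolynomial (Fin 3) ℂ) ^ (r + 2 - m1),
        X 1 ^ (r + 1 - m2), X 2 ^ (r + 2 - m3),
        (X 0 * X 1) ^ m3, (X 1 * X 2) ^ m1, (X 2 * X 0) ^ (m2 + 1),
        X 0 * X 1 * X 2}
    (∀ g : ArGroup r 3, ∀ p ∈ I, actA (g : Fin 3 → ℂˣ) p ∈ I) ∧
    Module.finrank ℂ (MvPolynomial (Fin 3) ℂ ⧸ I) = (r + 1) ^ 2 ∧
    ∀ ρ : ArGroup r 3 →* ℂˣ,
      ∃ w ∈ iso r 3 I ρ, w ≠ 0 ∧ ∀ w' ∈ iso r 3 I ρ, ∃ a : ℂ, w' = a • w := by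
  intro I
  have hI : I = monomialIdeal (generatorExponents r m1 m2 m3) :=
    monomialIdeal_generatorExponents.symm
  have hbij := bijective_exponentWeight hm1 hm3 hsum
  rw [hI]
  refine ⟨fun g p hp => actA_mem_monomialIdeal _ hp, ?_, fun ρ => ?_⟩
  · have := Finite.of_injective _ hbij.injective
    rw [finrank_quotient_monomialIdeal, Nat.card_eq_of_bijective _ hbij, Nat.card_prod,
      Nat.card_zmod, sq]
  · obtain ⟨x, y, hxy⟩ := exists_zmod_forall_weight_eq_iff ρ
    refine exists_iso_monomialIdeal_eq_span ?_
    obtain ⟨e, he, huniq⟩ := hbij.existsUnique (x, y)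
    refine ⟨e, ⟨e.2, (hxy e).2 (Prod.mk.inj he)⟩, fun f hf => ?_⟩
    exact congrArg Subtype.val (huniq ⟨f, hf.1⟩ (Prod.ext_iff.2 ((hxy f).1 hf.2)))
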